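/- arXiv:2601.07137 — 3 statements merged into one kernel-verified Lean document; each statement's English description precedes it below -/
import Mathlib

section
/- Let q be a prime, let c, M, k be positive integers with c < M < q, and let A(X) ∈ 𝔽_q[X] be a nonzero polynomial with deg(A) < cq and pseudodegree strictly less than k. Then the number of α ∈ 𝔽_q with mult(A, α) ≥ M is at most min( (c/(M−c+1))·k + c , k ). -/
open Polynomial

theorem aux_sum (S : Finset ℕ) : ∀ m : ℕ, (∀ x ∈ S, x ≤ m) →
    ∑ x ∈ S, x + ∑ i ∈ Finset.range S.card, i ≤ S.card * m := by
  induction S using Finset.induction_on_max with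
  | empty => simp
  | insert a s hs ih =>
    intro m hm
    have ha : a ∉ s := fun h => lt_irrefl _ (hs a h)
    rw [Finset.sum_insert ha, Finset.card_insert_of_notMem ha, Finset.sum_range_succ]
    have h1 := ih (a - 1) (fun x hx => by have := hs x hx; omega)
    have h2 : a ≤ m := hm a (Finset.mem_insert_self _ _)
    rcases Nat.eq_zero_or_pos a with h0 | h0
    · have : s = ∅ := by
        apply Finset.eq_empty_of_forall_notMem
        intro x hx; have := hs x hx; omega
      subst this; subst h0; simp
    · obtain ⟨b, rfl⟩ : ∃ b, a = b + 1 := ⟨a - 1, by omega⟩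
      simp only [Nat.add_sub_cancel] at h1
      nlinarith

theorem aux_prod {F : Type*} [Field F] {ι : Type*} (s : Finset ι) (f : ι → F[X]) (d : ι → ℕ)
    (h : ∀ i, (f i).natDegree ≤ d i) :
    (∏ i ∈ s, f i).natDegree ≤ ∑ i ∈ s, d i ∧
    (∏ i ∈ s, f i).coeff (∑ i ∈ s, d i) = ∏ i ∈ s, (f i).coeff (d i) := by
  classical
  induction s using Finset.induction_on with
  | empty => simp
  | insert a s ha ih =>
    rw [Finset.prod_insert ha, Finset.sum_insert ha, Finset.prod_insert ha]
    refine ⟨natDegree_mul_le_of_le (h a) ih.1, ?_⟩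
    rw [coeff_mul_add_eq_of_natDegree_le (h a) ih.1, ih.2]

theorem aux_wr {F : Type*} [Field F] (q : ℕ) [Fact q.Prime] [CharP F q] {r : ℕ} (e : Fin r → ℕ)
    (hinj : Function.Injective e) (heq : ∀ i, e i < q) (D : Fin r → F[X])
    (hD : ∀ i, (D i).Monic) (hDe : ∀ i, (D i).natDegree = e i) :
    (Matrix.of fun i j : Fin r => derivative^[(j : ℕ)] (D i)).det ≠ 0 ∧
    (Matrix.of fun i j : Fin r => derivative^[(j : ℕ)] (D i)).det.natDegree + ∑ j : Fin r, (j : ℕ)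
      ≤ ∑ i, e i := by
  set W := (Matrix.of fun i j : Fin r => derivative^[(j : ℕ)] (D i)) with hW
  set V : Matrix (Fin r) (Fin r) F[X] :=
    Matrix.of fun i j : Fin r => X ^ (j : ℕ) * derivative^[(j : ℕ)] (D i) with hV
  have hdet : V.det = X ^ (∑ j : Fin r, (j : ℕ)) * W.det := by
    rw [← Finset.prod_pow_eq_pow_sum]
    exact Matrix.det_mul_row (fun j : Fin r => (X : F[X]) ^ (j : ℕ)) W
  have hVd : ∀ i j, (V i j).natDegree ≤ e i := by
    intro i j
    rw [natDegree_le_iff_coeff_eq_zero]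
    intro N hN
    simp only [hV, Matrix.of_apply]
    rw [coeff_X_pow_mul']
    split_ifs with h
    · rw [coeff_iterate_derivative, coeff_eq_zero_of_natDegree_lt, smul_zero]
      rw [hDe]; omega
    · rfl
  have hVc : ∀ i j, (V i j).coeff (e i) = (descPochhammer F j).eval (e i : F) := by
    intro i j
    simp only [hV, Matrix.of_apply]
    rw [coeff_X_pow_mul', descPochhammer_eval_eq_descFactorial]
    split_ifs with h
    · rw [coeff_iterate_derivative, Nat.sub_add_cancel h, ← hDe i, coeff_natDegree, hD i]
      simp
    · rw [Nat.descFactorial_of_lt (by omega)]; simp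
  have hdeg : V.det.natDegree ≤ ∑ i, e i := by
    rw [← Matrix.det_transpose, Matrix.det_apply]
    apply natDegree_sum_le_of_forall_le
    intro σ _
    refine (natDegree_smul_le _ _).trans ?_
    exact (aux_prod Finset.univ (fun i => V.transpose (σ i) i) e (fun i => hVd i (σ i))).1
  have hcoef : V.det.coeff (∑ i, e i) = (Matrix.vandermonde fun i => (e i : F)).det := by
    rw [Matrix.det_eval_matrixOfPolynomials_eq_det_vandermonde _ (fun j : Fin r => descPochhammer F j)
      (fun i => descPochhammer_natDegree F i) (fun i => monic_descPochhammer F i)]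
    rw [← Matrix.det_transpose, Matrix.det_apply, ← Matrix.det_transpose, Matrix.det_apply,
      finsetSum_coeff]
    refine Finset.sum_congr rfl fun σ _ => ?_
    rw [coeff_smul]
    rw [(aux_prod Finset.univ (fun i => V.transpose (σ i) i) e (fun i => hVd i (σ i))).2]
    congr 1
    refine Finset.prod_congr rfl fun i _ => ?_
    exact hVc i (σ i)
  have hne : V.det ≠ 0 := by
    intro h0
    rw [h0, coeff_zero] at hcoef
    refine Matrix.det_vandermonde_ne_zero_iff.2 ?_ hcoef.symm
    intro i j hij
    apply hinj
    exact CharP.natCast_injOn_Iio F q (heq i) (heq j) hij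
  have hWne : W.det ≠ 0 := by
    rintro h; rw [h, mul_zero] at hdet; exact hne hdet
  refine ⟨hWne, ?_⟩
  rw [hdet, natDegree_mul (pow_ne_zero _ X_ne_zero) hWne, natDegree_X_pow] at hdeg
  omega

section
variable {F : Type*} [Field F]

theorem aux_lam (q : ℕ) (hq : 1 < q) : (X ^ q - X : F[X]).Monic ∧ (X ^ q - X : F[X]).natDegree = q := by
  refine ⟨?_, FiniteField.X_pow_card_sub_X_natDegree_eq F hq⟩
  apply monic_X_pow_sub
  rw [degree_X]; exact_mod_cast hq

theorem aux_div (g A : F[X]) (hg : g.Monic) (q n : ℕ) (hgq : g.natDegree = q)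
    (hA : A.degree < (((n + 1) * q : ℕ) : WithBot ℕ)) :
    (A /ₘ g).degree < ((n * q : ℕ) : WithBot ℕ) := by
  by_cases h0 : A /ₘ g = 0
  · rw [h0, degree_zero]; exact WithBot.bot_lt_coe _
  have hA0 : A ≠ 0 := by rintro rfl; simp at h0
  rw [← natDegree_lt_iff_degree_lt hA0] at hA
  rw [← natDegree_lt_iff_degree_lt h0, natDegree_divByMonic _ hg, hgq]
  have : ¬ A.degree < g.degree := fun h => h0 ((divByMonic_eq_zero_iff hg).2 h)
  have h2 : q ≤ A.natDegree := by
    rw [← hgq]; exact natDegree_le_natDegree (not_lt.1 this)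
  rw [add_mul] at hA; omega

theorem aux_leib (q : ℕ) [CharP F q] (G : F[X]) (l : ℕ) :
    derivative^[l + 1] ((X ^ q - X) * G) =
      (X ^ q - X) * derivative^[l + 1] G - ((l + 1 : ℕ) : F) • derivative^[l] G := by
  have hd : derivative (X ^ q - X : F[X]) = -1 := by
    simp [derivative_X_pow]
  induction l with
  | zero => simp [derivative_mul, hd]; ring
  | succ l ih =>
    rw [Function.iterate_succ_apply', ih, derivative_sub, derivative_mul, hd, derivative_smul,
      ← Function.iterate_succ_apply' derivative, ← Function.iterate_succ_apply' derivative]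
    simp only [smul_eq_C_mul]
    push_cast
    simp only [map_add, map_natCast, map_one]
    ring

theorem aux_step (q : ℕ) [Fact q.Prime] [CharP F q] (k n : ℕ) (hn : n < q) (A : F[X])
    (hd : ∀ l < n + 1, (derivative^[l] A %ₘ (X ^ q - X)).degree < (k : WithBot ℕ)) :
    ∀ l < n, (derivative^[l] (A /ₘ (X ^ q - X)) %ₘ (X ^ q - X)).degree < (k : WithBot ℕ) := by
  intro l hl
  have hm := (aux_lam (F := F) q (Fact.out : q.Prime).one_lt).1
  set L : F[X] := X ^ q - X with hL
  have h0 : (A %ₘ L).degree < (k : WithBot ℕ) := by simpa using hd 0 (by omega)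
  have h1 := hd (l + 1) (by omega)
  have hsplit := modByMonic_add_div A L
  set G := A /ₘ L
  have h2 : derivative^[l + 1] A = derivative^[l + 1] (A %ₘ L) +
      (L * derivative^[l + 1] G - ((l + 1 : ℕ) : F) • derivative^[l] G) := by
    rw [← aux_leib q G l, ← iterate_map_add, hsplit]
  have hu : ((l + 1 : ℕ) : F) ≠ 0 := by
    rw [Ne, CharP.cast_eq_zero_iff F q]
    exact Nat.not_dvd_of_pos_of_lt (by omega) (by omega)
  have h3 : derivative^[l] G = ((l + 1 : ℕ) : F)⁻¹ • (derivative^[l + 1] (A %ₘ L) +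
      L * derivative^[l + 1] G - derivative^[l + 1] A) := by
    rw [h2, ← add_sub_assoc, sub_sub_cancel, smul_smul, inv_mul_cancel₀ hu, one_smul]
  rw [h3, smul_modByMonic, sub_modByMonic, add_modByMonic, self_mul_modByMonic hm, add_zero]
  refine (degree_smul_le _ _).trans_lt ((degree_sub_le _ _).trans_lt (max_lt ?_ h1))
  refine degree_modByMonic_le_left.trans_lt (lt_of_le_of_lt ?_ h0)
  generalize A %ₘ L = B
  generalize l + 1 = m
  induction m with
  | zero => simp
  | succ m ih => rw [Function.iterate_succ_apply']; exact (degree_derivative_le).trans ih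

theorem aux_easy [Fintype F] (q : ℕ) [Fact q.Prime] [CharP F q] (hq : Fintype.card F = q) (k : ℕ)
    (S : Finset F) (c : ℕ) : ∀ (M : ℕ) (A : F[X]), c ≤ M → c ≤ q → A ≠ 0 →
    A.degree < ((c * q : ℕ) : WithBot ℕ) →
    (∀ l < c, (derivative^[l] A %ₘ (X ^ q - X)).degree < (k : WithBot ℕ)) →
    (∀ α ∈ S, (X - C α) ^ M ∣ A) → S.card ≤ k := by
  have hp : q.Prime := Fact.out
  obtain ⟨hm, hnd⟩ := aux_lam (F := F) q hp.one_lt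
  have hroot : ∀ α : F, (X - C α) ∣ (X ^ q - X : F[X]) := by
    intro α
    rw [dvd_iff_isRoot, IsRoot.def]
    simp [← hq, FiniteField.pow_card]
  induction c with
  | zero =>
    intro M A _ _ hA hd
    simp only [zero_mul, Nat.cast_zero] at hd
    exact absurd (zero_le_degree_iff.2 hA) (not_le.2 hd)
  | succ c ih =>
    intro M A hM hcq hA hd hl hS
    by_cases h0 : A %ₘ (X ^ q - X) = 0
    · have hsplit := modByMonic_add_div A (X ^ q - X)
      rw [h0, zero_add] at hsplit
      obtain ⟨N, rfl⟩ : ∃ N, M = N + 1 := ⟨M - 1, by omega⟩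
      refine ih N (A /ₘ (X ^ q - X)) (by omega) (by omega) ?_ (aux_div _ A hm q c hnd hd)
        (aux_step q k c (by omega) A hl) ?_
      · intro h; rw [h, mul_zero] at hsplit; exact hA hsplit.symm
      · intro α hα
        have h1 := hS α hα
        rw [← hsplit] at h1
        obtain ⟨R, hR⟩ := hroot α
        have hRne : ¬ (X - C α) ∣ R := by
          rintro ⟨R', hR'⟩
          have h2 : derivative (X ^ q - X : F[X]) = -1 := by simp [derivative_X_pow]
          rw [hR, hR'] at h2
          have := congrArg (eval α) h2
          simp [derivative_mul] at this
        generalize A /ₘ (X ^ q - X) = G at h1 ⊢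
        rw [hR, pow_succ', mul_assoc] at h1
        have h3 := (mul_dvd_mul_iff_left (X_sub_C_ne_zero α)).1 h1
        exact (prime_X_sub_C α).pow_dvd_of_dvd_mul_left N hRne h3
    · have h1 : (A %ₘ (X ^ q - X)).degree < (k : WithBot ℕ) := by simpa using hl 0 (by omega)
      rw [← natDegree_lt_iff_degree_lt h0] at h1
      refine le_trans ?_ h1.le
      apply card_le_degree_of_subset_roots
      intro α hα
      rw [mem_roots h0, ← dvd_iff_isRoot]
      have h2 : (X - C α) ∣ A := (dvd_pow_self _ (by omega)).trans (hS α hα)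
      rw [← modByMonic_add_div A (X ^ q - X)] at h2
      exact (dvd_add_left ((hroot α).mul_right _)).1 h2

theorem aux_dig (q : ℕ) (c : ℕ) : ∀ A : F[X], A.degree < ((c * q : ℕ) : WithBot ℕ) →
    ∃ B : ℕ → F[X], (∀ j, (B j).degree < (q : WithBot ℕ)) ∧
      A = ∑ j ∈ Finset.range c, B j * X ^ (q * j) := by
  induction c with
  | zero =>
    intro A hA
    refine ⟨fun _ => 0, fun j => by simpa using WithBot.bot_lt_coe q, ?_⟩
    simpa [degree_lt_iff_coeff_zero, Polynomial.ext_iff] using hA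
  | succ c ih =>
    intro A hA
    obtain ⟨B, hB, hs⟩ := ih _ (aux_div (X ^ q) A (monic_X_pow q) q c (natDegree_X_pow q) hA)
    refine ⟨fun j => Nat.casesOn j (A %ₘ X ^ q) B, ?_, ?_⟩
    · rintro (_ | j)
      · simpa using degree_modByMonic_lt A (monic_X_pow (R := F) q)
      · exact hB j
    · rw [Finset.sum_range_succ']
      simp only [mul_zero, pow_zero, mul_one]
      conv_lhs => rw [← modByMonic_add_div A (X ^ q), hs]
      rw [add_comm, Finset.mul_sum]
      congr 1
      refine Finset.sum_congr rfl fun j _ => ?_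
      rw [mul_add, pow_add]; ring

theorem aux_dig2 (q : ℕ) [Fact q.Prime] [CharP F q] (k : ℕ) (c : ℕ) : ∀ A : F[X],
    c ≤ q → A.degree < ((c * q : ℕ) : WithBot ℕ) →
    (∀ l < c, (derivative^[l] A %ₘ (X ^ q - X)).degree < ((k + 1 : ℕ) : WithBot ℕ)) →
    ∃ B : ℕ → F[X], (∀ j, (B j).degree < ((k + c : ℕ) : WithBot ℕ)) ∧ (∀ j, c ≤ j → B j = 0) ∧
      A = ∑ j ∈ Finset.range c, B j * X ^ (q * j) := by
  have hp : q.Prime := Fact.out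
  obtain ⟨hm, hnd⟩ := aux_lam (F := F) q hp.one_lt
  induction c with
  | zero =>
    intro A _ hA _
    refine ⟨fun _ => 0, fun j => by simpa using WithBot.bot_lt_coe _, fun _ _ => rfl, ?_⟩
    simpa [degree_lt_iff_coeff_zero, Polynomial.ext_iff] using hA
  | succ c ih =>
    intro A hcq hA hl
    obtain ⟨B, hB, hB0, hs⟩ := ih _ (by omega) (aux_div _ A hm q c hnd hA)
      (aux_step q (k + 1) c (by omega) A hl)
    have h1 : (A %ₘ (X ^ q - X)).degree < ((k + 1 : ℕ) : WithBot ℕ) := by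
      simpa using hl 0 (by omega)
    rw [degree_lt_iff_coeff_zero] at h1
    simp only [degree_lt_iff_coeff_zero] at hB
    have hXB : ∀ j m, k + (c + 1) ≤ m → (X * B j).coeff m = 0 := by
      intro j m hm
      obtain ⟨m, rfl⟩ : ∃ n, m = n + 1 := ⟨m - 1, by omega⟩
      rw [coeff_X_mul]; exact hB j m (by omega)
    refine ⟨fun j => (Nat.casesOn j (A %ₘ (X ^ q - X)) B : F[X]) - X * B j, ?_, ?_, ?_⟩
    · intro j
      rw [degree_lt_iff_coeff_zero]
      intro m hm
      rw [coeff_sub, hXB j m hm, sub_zero]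
      rcases j with _ | j
      · exact h1 m (by omega)
      · exact hB j m (by omega)
    · rintro (_ | j) hj
      · omega
      · simp [hB0 j (by omega), hB0 (j + 1) (by omega)]
    · simp only [sub_mul, Finset.sum_sub_distrib]
      rw [Finset.sum_range_succ', Finset.sum_range_succ (fun j => X * B j * X ^ (q * j)),
        hB0 c le_rfl]
      simp only [mul_zero, pow_zero, mul_one, zero_mul, add_zero]
      conv_lhs => rw [← modByMonic_add_div A (X ^ q - X), hs]
      have e1 : X ^ q * ∑ j ∈ Finset.range c, B j * X ^ (q * j) =
          ∑ j ∈ Finset.range c, B j * X ^ (q * (j + 1)) := by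
        rw [Finset.mul_sum]
        refine Finset.sum_congr rfl fun j _ => ?_
        rw [mul_add, pow_add]; ring
      have e2 : X * ∑ j ∈ Finset.range c, B j * X ^ (q * j) =
          ∑ j ∈ Finset.range c, X * B j * X ^ (q * j) := by
        rw [Finset.mul_sum]
        refine Finset.sum_congr rfl fun j _ => ?_
        ring
      rw [sub_mul, e1, e2]
      change _ = _ + A %ₘ (X ^ q - X) - _
      generalize A %ₘ (X ^ q - X) = A0
      ring

theorem aux_basis (V : Submodule F F[X]) (q : ℕ) (hV : ∀ v ∈ V, v.degree < (q : WithBot ℕ)) :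
    ∃ (T : Finset ℕ) (D : ℕ → F[X]), (∀ e ∈ T, e < q) ∧
      (∀ e ∈ T, D e ∈ V ∧ (D e).Monic ∧ (D e).natDegree = e) ∧
      V ≤ Submodule.span F (D '' T) := by
  classical
  let T := (Finset.range q).filter (fun e => ∃ v ∈ V, v.Monic ∧ v.natDegree = e)
  have h : ∀ e, ∃ v : F[X], e ∈ T → v ∈ V ∧ v.Monic ∧ v.natDegree = e := by
    intro e
    by_cases he : e ∈ T
    · obtain ⟨v, hv⟩ := (Finset.mem_filter.1 he).2
      exact ⟨v, fun _ => hv⟩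
    · exact ⟨0, fun h => absurd h he⟩
  choose D hD using h
  refine ⟨T, D, fun e he => Finset.mem_range.1 (Finset.mem_filter.1 he).1, fun e he => hD e he, ?_⟩
  have key : ∀ n : ℕ, ∀ v ∈ V, v.degree < (n : WithBot ℕ) → v ∈ Submodule.span F (D '' T) := by
    intro n
    induction n with
    | zero =>
      intro v _ hv
      have : v = 0 := by
        simpa [degree_lt_iff_coeff_zero, Polynomial.ext_iff] using hv
      rw [this]; exact Submodule.zero_mem _
    | succ n ih =>
      intro v hvV hv
      have hvq := hV v hvV
      rw [degree_lt_iff_coeff_zero] at hv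
      by_cases ha : v.coeff n = 0
      · apply ih v hvV
        rw [degree_lt_iff_coeff_zero]
        intro m hm
        rcases Nat.eq_or_lt_of_le hm with h | h
        · rw [← h]; exact ha
        · exact hv m h
      · have hv0 : v ≠ 0 := by rintro rfl; simp at ha
        have hnd : v.natDegree = n := by
          apply le_antisymm
          · rw [natDegree_le_iff_coeff_eq_zero]; intro N hN; exact hv N hN
          · exact le_natDegree_of_ne_zero ha
        have hnT : n ∈ T := by
          refine Finset.mem_filter.2 ⟨?_, (v.coeff n)⁻¹ • v, V.smul_mem _ hvV, ?_, ?_⟩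
          · rw [← natDegree_lt_iff_degree_lt hv0] at hvq
            exact Finset.mem_range.2 (hnd ▸ hvq)
          · rw [smul_eq_C_mul, mul_comm, ← hnd]
            exact monic_mul_leadingCoeff_inv hv0
          · rw [natDegree_smul _ (inv_ne_zero ha), hnd]
        obtain ⟨h1, h2, h3⟩ := hD n hnT
        have h4 : v - v.coeff n • D n ∈ Submodule.span F (D '' T) := by
          apply ih _ (V.sub_mem hvV (V.smul_mem _ h1))
          rw [degree_lt_iff_coeff_zero]
          intro m hm
          rw [coeff_sub, coeff_smul]
          rcases Nat.eq_or_lt_of_le hm with h | h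
          · have : (D n).coeff n = 1 := by
              have := h2.coeff_natDegree; rwa [h3] at this
            rw [← h, this]; simp
          · rw [hv m h, coeff_eq_zero_of_natDegree_lt (by omega : (D n).natDegree < m)]; simp
        have h5 := Submodule.add_mem _ h4 (Submodule.smul_mem _ (v.coeff n)
          (Submodule.subset_span (Set.mem_image_of_mem D (Finset.mem_coe.2 hnT))))
        rwa [sub_add_cancel] at h5
  intro v hv
  exact key q v hv (hV v hv)

theorem aux_main [Fintype F] [DecidableEq F] (q : ℕ) [Fact q.Prime] [CharP F q]
    (hq : Fintype.card F = q) (m c M : ℕ)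
    (hcM : c < M) (hMq : M < q) (A : F[X]) (hA : A ≠ 0) (B : ℕ → F[X])
    (hBq : ∀ j, (B j).degree < (q : WithBot ℕ)) (hBm : ∀ j, (B j).degree < ((m + 1 : ℕ) : WithBot ℕ))
    (hAB : A = ∑ j ∈ Finset.range c, B j * X ^ (q * j))
    (S : Finset F) (hS : ∀ α ∈ S, (X - C α) ^ M ∣ A) :
    ∃ r g, r ≤ c ∧ S.card ≤ g + c ∧
      g * (M - r + 1) + 2 * ∑ i ∈ Finset.range r, i ≤ r * m := by
  set V := Submodule.span F (((Finset.range c).image B : Finset F[X]) : Set F[X]) with hVdef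
  have hVdeg : ∀ n : ℕ, (∀ j, (B j).degree < (n : WithBot ℕ)) → ∀ v ∈ V, v.degree < (n : WithBot ℕ) := by
    intro n hn v hv
    rw [← mem_degreeLT]
    refine (Submodule.span_le.2 ?_) hv
    intro x hx
    simp only [Finset.coe_image, Set.mem_image] at hx
    obtain ⟨j, _, rfl⟩ := hx
    exact mem_degreeLT.2 (hn j)
  obtain ⟨T, D, hTq, hD, hspan⟩ := aux_basis V q (hVdeg q hBq)
  have hTm : ∀ e ∈ T, e ≤ m := by
    intro e he
    obtain ⟨h1, h2, h3⟩ := hD e he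
    have := hVdeg _ hBm _ h1
    rw [← natDegree_lt_iff_degree_lt h2.ne_zero, h3] at this
    omega
  set r := T.card with hr
  let e : Fin r ↪o ℕ := T.orderEmbOfFin rfl
  have heT : ∀ i, e i ∈ T := fun i => T.orderEmbOfFin_mem rfl i
  let W : Matrix (Fin r) (Fin r) F[X] := Matrix.of fun i j : Fin r => derivative^[(j : ℕ)] (D (e i))
  obtain ⟨hWne, hWdeg⟩ := aux_wr q e e.injective (fun i => hTq _ (heT i)) (fun i => D (e i))
    (fun i => (hD _ (heT i)).2.1) (fun i => (hD _ (heT i)).2.2)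
  change W.det ≠ 0 at hWne
  change W.det.natDegree + _ ≤ _ at hWdeg
  have hrange : Set.range (fun i => D (e i)) = D '' T := by
    have : Set.range e = T := T.range_orderEmbOfFin rfl
    rw [← this, ← Set.range_comp]; rfl
  have hvec : ∀ (g : Fin r → F) (j : Fin r), Matrix.vecMul (fun i => C (g i)) W j =
      derivative^[(j : ℕ)] (∑ i, g i • D (e i)) := by
    intro g j
    simp only [Matrix.vecMul, dotProduct, W, Matrix.of_apply]
    rw [iterate_derivative_sum]
    refine Finset.sum_congr rfl fun i _ => ?_
    rw [iterate_derivative_smul, smul_eq_C_mul]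
  have hli : LinearIndependent F (fun i => D (e i)) := by
    rw [Fintype.linearIndependent_iff]
    intro g hg i
    have h1 : Matrix.vecMul (fun i => C (g i)) W = 0 := by
      funext j
      rw [hvec, hg]; simp
    have h2 := congrFun (Matrix.eq_zero_of_vecMul_eq_zero hWne h1) i
    simpa using h2
  have hrc : r ≤ c := by
    have h1 := linearIndependent_le_span' (fun i => D (e i)) hli
      (((Finset.range c).image B : Finset F[X]) : Set F[X]) (by
        rintro _ ⟨i, rfl⟩
        exact (hD _ (heT i)).1)
    have h2 : ((Finset.range c).image B).card ≤ c := by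
      simpa using Finset.card_image_le (s := Finset.range c) (f := B)
    rw [Cardinal.mk_fin, Nat.cast_le] at h1
    erw [Fintype.card_coe] at h1
    omega
  have ha : ∀ j, ∃ a : Fin r → F, j < c → ∑ i, a i • D (e i) = B j := by
    intro j
    by_cases hj : j < c
    · have h1 : B j ∈ Submodule.span F (Set.range fun i => D (e i)) := by
        rw [hrange]
        apply hspan
        apply Submodule.subset_span
        exact Finset.mem_coe.2 (Finset.mem_image_of_mem _ (Finset.mem_range.2 hj))
      obtain ⟨a, ha⟩ := (Submodule.mem_span_range_iff_exists_fun F).1 h1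
      exact ⟨a, fun _ => ha⟩
    · exact ⟨0, fun h => absurd h hj⟩
  choose a ha using ha
  let E : Fin r → F[X] := fun i => ∑ j ∈ Finset.range c, monomial j (a j i)
  have hEcoeff : ∀ i j, j < c → (E i).coeff j = a j i := by
    intro i j hj
    simp only [E, finsetSum_coeff, coeff_monomial]
    simp [hj]
  have hEdeg : ∀ i, (E i).natDegree ≤ c := by
    intro i
    apply natDegree_sum_le_of_forall_le
    intro j hj
    exact (natDegree_monomial_le _).trans (Finset.mem_range.1 hj).le
  have hE : ∃ i, E i ≠ 0 := by
    by_contra! h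
    apply hA
    rw [hAB]
    apply Finset.sum_eq_zero
    intro j hj
    have hj' := Finset.mem_range.1 hj
    rw [← ha j hj', Finset.sum_eq_zero, zero_mul]
    intro i _
    rw [← hEcoeff i j hj', h i]; simp
  obtain ⟨i0, hi0⟩ := hE
  have hmod : ∀ α ∈ S, (X - C α) ^ M ∣ ∑ i, (E i).eval α • D (e i) := by
    intro α hα
    have h1 : ∑ i, (E i).eval α • D (e i) = ∑ j ∈ Finset.range c, B j * C α ^ j := by
      have : ∀ j ∈ Finset.range c, B j * C α ^ j = ∑ i, (a j i * α ^ j) • D (e i) := by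
        intro j hj
        rw [← ha j (Finset.mem_range.1 hj), Finset.sum_mul]
        refine Finset.sum_congr rfl fun i _ => ?_
        simp only [smul_eq_C_mul, C_mul, C_pow]; ring
      rw [Finset.sum_congr rfl this, Finset.sum_comm]
      refine Finset.sum_congr rfl fun i _ => ?_
      rw [← Finset.sum_smul]
      simp [E, eval_finsetSum]
    have h2 : A - ∑ j ∈ Finset.range c, B j * C α ^ j =
        ∑ j ∈ Finset.range c, B j * ((X ^ q) ^ j - (C α) ^ j) := by
      rw [hAB, ← Finset.sum_sub_distrib]
      refine Finset.sum_congr rfl fun j _ => ?_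
      rw [pow_mul]; ring
    have h3 : (X - C α) ^ q = X ^ q - C α := by
      rw [sub_pow_char, ← C_pow, ← hq, FiniteField.pow_card]
    have h4 : (X - C α) ^ M ∣ A - ∑ j ∈ Finset.range c, B j * C α ^ j := by
      rw [h2]
      apply Finset.dvd_sum
      intro j _
      apply Dvd.dvd.mul_left
      refine (pow_dvd_pow _ hMq.le).trans ?_
      rw [h3]
      exact sub_dvd_pow_sub_pow _ _ _
    rw [h1]
    exact (dvd_sub_right (hS α hα)).1 h4
  let G := S.filter (fun α => ∃ i, (E i).eval α ≠ 0)
  have hG : ∀ α ∈ G, (X - C α) ^ (M - r + 1) ∣ W.det := by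
    intro α hα
    obtain ⟨hαS, i, hi⟩ := Finset.mem_filter.1 hα
    have h1 : ∀ j, (X - C α) ^ (M - r + 1) ∣
        Matrix.vecMul (fun i => C ((E i).eval α)) W j := by
      intro j
      rw [hvec]
      refine dvd_trans (pow_dvd_pow _ ?_) (pow_sub_dvd_iterate_derivative_of_pow_dvd (j : ℕ) (hmod α hαS))
      have := j.2
      omega
    have h2 : Matrix.vecMul (Matrix.vecMul (fun i => C ((E i).eval α)) W) W.adjugate i =
        W.det * C ((E i).eval α) := by
      rw [Matrix.vecMul_vecMul, Matrix.mul_adjugate, Matrix.vecMul_smul, Matrix.vecMul_one]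
      rfl
    have h3 : (X - C α) ^ (M - r + 1) ∣ W.det * C ((E i).eval α) := by
      rw [← h2]
      simp only [Matrix.vecMul, dotProduct]
      apply Finset.dvd_sum
      intro j _
      exact (h1 j).mul_right _
    have hu : IsUnit (C ((E i).eval α)) := isUnit_C.2 (isUnit_iff_ne_zero.2 hi)
    exact hu.dvd_mul_right.1 h3
  have hGdeg : G.card * (M - r + 1) ≤ W.det.natDegree := by
    have h1 : ∏ α ∈ G, (X - C α) ^ (M - r + 1) ∣ W.det := by
      apply Finset.prod_dvd_of_coprime
      · intro α _ β _ hne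
        exact (pairwise_coprime_X_sub_C (s := fun x : F => x) Function.injective_id hne).pow
      · exact hG
    have h2 := natDegree_le_of_dvd h1 hWne
    rw [natDegree_prod_of_monic _ _ (fun α _ => (monic_X_sub_C α).pow _)] at h2
    simpa [natDegree_pow] using h2
  have hbad : (S.filter (fun α => ¬ ∃ i, (E i).eval α ≠ 0)).card ≤ c := by
    refine le_trans ?_ (hEdeg i0)
    apply card_le_degree_of_subset_roots
    intro α hα
    have h1 := (Finset.mem_filter.1 (show α ∈ S.filter _ from hα)).2
    push Not at h1
    rw [mem_roots hi0]
    exact h1 i0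
  refine ⟨r, G.card, hrc, ?_, ?_⟩
  · have := Finset.card_filter_add_card_filter_not (s := S) (fun α => ∃ i, (E i).eval α ≠ 0)
    change G.card + _ = _ at this
    omega
  · have h1 := aux_sum T m hTm
    have h2 : ∑ i, e i = ∑ x ∈ T, x := by
      have : Finset.univ.map e.toEmbedding = T := by simp [e]
      conv_rhs => rw [← this]
      rw [Finset.sum_map]; rfl
    have h3 : ∑ j : Fin r, (j : ℕ) = ∑ i ∈ Finset.range r, i := Fin.sum_univ_eq_sum_range (fun i => i) r
    rw [h2, h3] at hWdeg
    rw [← hr] at h1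
    omega
end

theorem aux_arith (r g c M k : ℕ) (hrc : r ≤ c) (hcM : c < M) (hck : c < k)
    (h : g * (M - r + 1) + 2 * ∑ i ∈ Finset.range r, i ≤ r * (k + c - 2)) :
    g * (M - c + 1) ≤ c * k := by
  have h2 := Finset.sum_range_id_mul_two r
  rw [mul_comm] at h2
  rw [h2] at h
  obtain ⟨t, rfl⟩ := Nat.exists_eq_add_of_le hrc
  obtain ⟨N, rfl⟩ := Nat.exists_eq_add_of_le hcM.le
  rw [show r + t + N - r + 1 = N + 1 + t by omega] at h
  rw [show r + t + N - (r + t) + 1 = N + 1 by omega]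
  rcases Nat.eq_zero_or_pos r with h0 | h0
  · subst h0
    have : g = 0 := by
      have : g * (N + 1 + t) = 0 := by omega
      rcases Nat.mul_eq_zero.1 this with h | h <;> omega
    subst this; simp
  · obtain ⟨s, rfl⟩ : ∃ s, r = s + 1 := ⟨r - 1, by omega⟩
    obtain ⟨u, rfl⟩ : ∃ u, k = s + 1 + t + u := ⟨k - (s + 1 + t), by omega⟩
    have e1 : s + 1 + t + u + (s + 1 + t) - 2 = s + (s + 2 * t + u) := by omega
    have e2 : s + 1 - 1 = s := rfl
    rw [e1, e2, mul_add] at h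
    have h3 : g * (N + 1 + t) ≤ (s + 1) * (s + 2 * t + u) := by linarith
    have hpos : 0 < N + 1 + t := by omega
    refine le_of_mul_le_mul_right ?_ hpos
    calc g * (N + 1) * (N + 1 + t) = g * (N + 1 + t) * (N + 1) := by ring
      _ ≤ (s + 1) * (s + 2 * t + u) * (N + 1) := Nat.mul_le_mul_right _ h3
      _ ≤ (s + 1 + t) * (s + 1 + t + u) * (N + 1) := by
          apply Nat.mul_le_mul_right
          nlinarith [Nat.zero_le (t * u), Nat.zero_le (t * t), Nat.zero_le (s * t)]
      _ ≤ _ := Nat.mul_le_mul_left _ (by omega)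

theorem stmt13 {F : Type*} [Field F] [Fintype F] (q : ℕ) (hq : Fintype.card F = q)
    (hqprime : q.Prime) (c M k : ℕ) (hc : 0 < c) (hk : 0 < k) (hcM : c < M) (hMq : M < q)
    (A : F[X]) (hA : A ≠ 0) (hdeg : A.degree < ((c * q : ℕ) : WithBot ℕ))
    (hpdeg : ∀ ℓ : ℕ, ((hasseDeriv ℓ A) %ₘ (X ^ q - X)).degree < (k : WithBot ℕ)) :
    ({α : F | (X - C α) ^ M ∣ A}.ncard : ℝ) ≤
      min ((c : ℝ) / ((M : ℝ) - (c : ℝ) + 1) * (k : ℝ) + (c : ℝ)) (k : ℝ) := by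
  classical
  haveI : Fact q.Prime := ⟨hqprime⟩
  haveI : CharP F q := charP_of_card_eq_prime hq
  have hpd : ∀ l : ℕ, (derivative^[l] A %ₘ (X ^ q - X)).degree < (k : WithBot ℕ) := by
    intro l
    rw [← factorial_smul_hasseDeriv, LinearMap.smul_apply, ← Nat.cast_smul_eq_nsmul F,
      smul_modByMonic]
    exact (degree_smul_le _ _).trans_lt (hpdeg l)
  let S : Finset F := Finset.univ.filter (fun α => (X - C α) ^ M ∣ A)
  have hSeq : {α : F | (X - C α) ^ M ∣ A}.ncard = S.card := by
    rw [← Set.ncard_coe_finset]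
    congr 1
    ext α; simp [S]
  have hS : ∀ α ∈ S, (X - C α) ^ M ∣ A := fun α h => (Finset.mem_filter.1 h).2
  rw [hSeq]
  have heasy : S.card ≤ k := aux_easy q hq k S c M A hcM.le (by omega) hA hdeg (fun l _ => hpd l) hS
  have hpos : (0 : ℝ) < (M : ℝ) - c + 1 := by
    have : (c : ℝ) < M := by exact_mod_cast hcM
    linarith
  refine le_min ?_ (by exact_mod_cast heasy)
  rcases le_or_gt k c with hkc | hck
  · have h1 : (S.card : ℝ) ≤ c := by exact_mod_cast heasy.trans hkc
    have : 0 ≤ (c : ℝ) / ((M : ℝ) - c + 1) * k := by positivity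
    linarith
  · have hB : ∃ B : ℕ → F[X], (∀ j, (B j).degree < (q : WithBot ℕ)) ∧
        (∀ j, (B j).degree < (((k + c - 2) + 1 : ℕ) : WithBot ℕ)) ∧
        A = ∑ j ∈ Finset.range c, B j * X ^ (q * j) := by
      rcases le_total q (k + c - 2 + 1) with h | h
      · obtain ⟨B, h1, h2⟩ := aux_dig q c A hdeg
        exact ⟨B, h1, fun j => (h1 j).trans_le (by exact_mod_cast h), h2⟩
      · obtain ⟨B, h1, _, h2⟩ := aux_dig2 q (k - 1) c A (by omega) hdeg (fun l _ => by
          rw [Nat.sub_add_cancel hk]; exact hpd l)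
        rw [show k - 1 + c = k + c - 2 + 1 by omega] at h1
        exact ⟨B, fun j => (h1 j).trans_le (by exact_mod_cast h), h1, h2⟩
    obtain ⟨B, h1, h2, h3⟩ := hB
    obtain ⟨r, g, hrc, hcard, hg⟩ := aux_main q hq (k + c - 2) c M hcM hMq A hA B h1 h2 h3 S hS
    have h4 := aux_arith r g c M k hrc hcM hck hg
    have h5 : (g : ℝ) * ((M : ℝ) - c + 1) ≤ c * k := by
      have : ((g * (M - c + 1) : ℕ) : ℝ) ≤ ((c * k : ℕ) : ℝ) := by exact_mod_cast h4
      push_cast [Nat.cast_sub hcM.le] at this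
      exact this
    have h6 : (g : ℝ) ≤ (c : ℝ) / ((M : ℝ) - c + 1) * k := by
      rw [div_mul_eq_mul_div, le_div_iff₀ hpos]; exact h5
    have h7 : (S.card : ℝ) ≤ g + c := by exact_mod_cast hcard
    linarith
end

section
/- Let q be a prime power, let m ≥ 2 and c, h, M be positive integers, let γ ∈ [0, 1) be a real number with c < (((m−1) − mγ)/m)·M, and let r_1, …, r_m : 𝔽_q → 𝔽_q be functions such that the number of α ∈ 𝔽_q for which r_i(α) ≠ r_j(α) for some pair i, j is at most γq. Suppose that for each i, F_i(X) ∈ 𝔽_q[X] has degree less than cq and is an r_i-twisted (h, M)-pseudopolynomial, and let k be an integer with k > (M/((m − 1 − mγ)M − mc))·(h + 1). Then there exist polynomials A_1(X), …, A_m(X) ∈ 𝔽_q[X], not all zero, each of degree less than Mq and pseudodegree at most k, such that Σ_{i=1}^{m} A_i(X)·F_i(X) = 0. -/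
open Polynomial

/-- `A ∈ 𝔽_q[X]` has pseudodegree at most `k`: for every `ℓ ≥ 0`, the remainder of the
`ℓ`-th Hasse derivative of `A` upon division by `Λ(X) = X^q - X` has degree at most `k`. -/
def PdegLE {F : Type*} [Field F] (q : ℕ) (A : F[X]) (k : ℕ) : Prop :=
  ∀ ℓ : ℕ, ((hasseDeriv ℓ A) %ₘ (X ^ q - X)).degree ≤ (k : WithBot ℕ)

/-- `P ∈ 𝔽_q[X]` is an `r`-twisted `(h, M)`-pseudopolynomial: for every `ℓ < M` there is
`U_ℓ ∈ 𝔽_q[X]` of degree at most `h` with `P^{[ℓ]}(α) = r(α)·U_ℓ(α)` for all `α ∈ 𝔽_q`. -/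
def Twisted {F : Type*} [Field F] (r : F → F) (h M : ℕ) (P : F[X]) : Prop :=
  ∀ ℓ < M, ∃ U : F[X], U.degree ≤ (h : WithBot ℕ) ∧
    ∀ α : F, (hasseDeriv ℓ P).eval α = r α * U.eval α

lemma pd_monic {F : Type*} [Field F] [Fintype F] (q : ℕ) (hq : Fintype.card F = q) :
    (X ^ q - X : F[X]).Monic ∧ (X ^ q - X : F[X]).natDegree = q := by
  have h1 : 1 < q := hq ▸ Fintype.one_lt_card
  exact ⟨monic_X_pow_sub (by simpa using h1), FiniteField.X_pow_card_sub_X_natDegree_eq F h1⟩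

noncomputable def pdK (F : Type*) [Field F] (q k : ℕ) : Submodule F F[X] :=
  (degreeLE F k).comap (modByMonicHom (X ^ q - X))

noncomputable def pdV (F : Type*) [Field F] (q k : ℕ) : Submodule F F[X] :=
  ⨅ ℓ, (pdK F q k).comap (hasseDeriv ℓ)

lemma mem_pdK {F : Type*} [Field F] {q k : ℕ} {A : F[X]} :
    A ∈ pdK F q k ↔ (A %ₘ (X ^ q - X)).degree ≤ (k : WithBot ℕ) := by
  simp [pdK, mem_degreeLE, modByMonicHom]

lemma mem_pdV {F : Type*} [Field F] {q k : ℕ} {A : F[X]} :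
    A ∈ pdV F q k ↔ PdegLE q A k := by
  simp [pdV, PdegLE, Submodule.mem_iInf, mem_pdK]

lemma pdK_mul {F : Type*} [Field F] [Fintype F] (q k : ℕ) (hq : Fintype.card F = q) (A : F[X]) :
    A * (X ^ q - X) ∈ pdK F q k := by
  rw [mem_pdK, (modByMonic_eq_zero_iff_dvd (pd_monic q hq).1).2 (Dvd.intro_left _ rfl)]
  simp

lemma hasse_Lam {F : Type*} [Field F] [Fintype F] (q : ℕ) (hq : Fintype.card F = q) (ℓ : ℕ)
    (hℓ : ℓ ≠ 0) : ∃ c : F, hasseDeriv ℓ (X ^ q - X : F[X]) = C c := by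
  obtain ⟨p, _, n, hp, hcard⟩ := FiniteField.card' F
  have h1 : ∃ c : F, hasseDeriv ℓ (X ^ q : F[X]) = C c := by
    rw [← monomial_one_right_eq_X_pow, hasseDeriv_monomial]
    by_cases h : ℓ = q
    · subst h; exact ⟨1, by simp⟩
    · refine ⟨0, ?_⟩
      have : ((q.choose ℓ : ℕ) : F) = 0 := by
        rw [CharP.cast_eq_zero_iff F p, ← hq, hcard]
        exact Nat.Prime.dvd_choose_pow hp hℓ (by rw [← hcard, hq]; exact h)
      simp [this]
  have h2 : ∃ c : F, hasseDeriv ℓ (X : F[X]) = C c := by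
    by_cases h : ℓ = 1
    · subst h; exact ⟨1, by simp⟩
    · exact ⟨0, by rw [hasseDeriv_X _ (by omega)]; simp⟩
  obtain ⟨a, ha⟩ := h1
  obtain ⟨b, hb⟩ := h2
  exact ⟨a - b, by rw [map_sub, ha, hb, C_sub]⟩

lemma pdV_mul {F : Type*} [Field F] [Fintype F] (q k : ℕ) (hq : Fintype.card F = q) (A : F[X])
    (hA : A ∈ pdV F q k) : A * (X ^ q - X) ∈ pdV F q k := by
  simp only [pdV, Submodule.mem_iInf, Submodule.mem_comap] at hA ⊢
  intro ℓ
  rw [hasseDeriv_mul]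
  refine Submodule.sum_mem _ ?_
  rintro ⟨a, b⟩ -
  by_cases hb : b = 0
  · subst hb
    simpa using pdK_mul q k hq (hasseDeriv a A)
  · obtain ⟨c, hc⟩ := hasse_Lam (F := F) q hq b hb
    simp only [hc]
    rw [mul_comm, ← smul_eq_C_mul]
    exact Submodule.smul_mem _ _ (hA a)

lemma pdV_basis {F : Type*} [Field F] [Fintype F] (q k : ℕ) (hq : Fintype.card F = q) (e j : ℕ)
    (he : e ≤ k) : (X ^ e * (X ^ q - X) ^ j : F[X]) ∈ pdV F q k := by
  induction j with
  | zero =>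
    rw [mem_pdV]
    intro ℓ
    refine (degree_modByMonic_le_left ..).trans ?_
    refine degree_le_of_natDegree_le ?_
    refine (natDegree_hasseDeriv_le _ _).trans ?_
    simp; omega
  | succ j ih =>
    rw [pow_succ, ← mul_assoc]
    exact pdV_mul q k hq _ ih

noncomputable def pdSeq (F : Type*) [Field F] [Fintype F] (q : ℕ) (hq : Fintype.card F = q) :
    Polynomial.Sequence F where
  elems' n := X ^ (n % q) * (X ^ q - X) ^ (n / q)
  degree_eq' n := by
    obtain ⟨h1, h2⟩ := pd_monic (F := F) q hq
    rw [degree_eq_natDegree ((monic_X_pow _).mul (h1.pow _)).ne_zero,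
      (monic_X_pow _).natDegree_mul (h1.pow _), h1.natDegree_pow, h2, natDegree_X_pow]
    rw [mul_comm, Nat.mod_add_div]

lemma core {F : Type*} [Field F] [Fintype F] (q : ℕ) (hq : Fintype.card F = q) (m N k : ℕ)
    {ι : Type*} [Fintype ι] (T : (Fin m → F[X]) →ₗ[F] (ι → F))
    (hcard : Fintype.card ι < m * ((Finset.range N).filter (fun n => n % q ≤ k)).card) :
    ∃ A : Fin m → F[X], (¬ ∀ i, A i = 0) ∧ (∀ i, (A i).degree < (N : WithBot ℕ)) ∧
      (∀ i, PdegLE q (A i) k) ∧ T A = 0 := by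
  classical
  set S := (Finset.range N).filter (fun n => n % q ≤ k) with hS
  have hS' : ∀ n ∈ S, n < N ∧ n % q ≤ k := by intro n hn; simpa [hS] using hn
  let L : (Fin m → S → F) →ₗ[F] (Fin m → F[X]) :=
    LinearMap.pi fun i => (Fintype.linearCombination F (fun n : S => pdSeq F q hq n)).comp
      (LinearMap.proj i)
  have hL : ∀ x i, L x i = ∑ n : S, x i n • pdSeq F q hq n := by
    intro x i; simp [L, Fintype.linearCombination_apply]
  have hker : LinearMap.ker (T.comp L) ≠ ⊥ := by
    apply LinearMap.ker_ne_bot_of_finrank_lt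
    have e : Module.finrank F (Fin m → S → F) = m * S.card := by
      rw [Module.finrank_pi_fintype]; simp
    rw [e]
    simpa using hcard
  obtain ⟨x, hx, hx0⟩ := Submodule.exists_mem_ne_zero_of_ne_bot hker
  refine ⟨L x, ?_, ?_, ?_, by simpa using hx⟩
  · intro h0
    apply hx0
    have hli : LinearIndependent F (fun n : S => pdSeq F q hq n) :=
      (pdSeq F q hq).linearIndependent.comp (fun n : S => (n : ℕ)) Subtype.val_injective
    rw [Fintype.linearIndependent_iff] at hli
    funext i n
    exact hli (x i) (by rw [← hL]; exact h0 i) n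
  · intro i
    rw [← mem_degreeLT, hL]
    refine Submodule.sum_mem _ fun n _ => Submodule.smul_mem _ _ ?_
    rw [mem_degreeLT, (pdSeq F q hq).degree_eq]
    exact_mod_cast (hS' n n.2).1
  · intro i
    rw [← mem_pdV, hL]
    refine Submodule.sum_mem _ fun n _ => Submodule.smul_mem _ _ ?_
    exact pdV_basis q k hq _ _ (hS' n n.2).2

lemma vanish {F : Type*} [Field F] (G : Finset F) (M : ℕ) (P : F[X])
    (hP : P.degree < ((M * G.card : ℕ) : WithBot ℕ))
    (h0 : ∀ α ∈ G, ∀ ℓ < M, (hasseDeriv ℓ P).eval α = 0) : P = 0 := by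
  have hd : ∀ α ∈ G, (X - C α) ^ M ∣ P := by
    intro α hα
    have h1 : X ^ M ∣ taylor α P := by
      rw [X_pow_dvd_iff]
      intro d hd
      rw [taylor_coeff]; exact h0 α hα d hd
    have h2 := map_dvd (taylorAlgHom (-α)) h1
    have e : taylorAlgHom (-α) (taylor α P) = P := by
      change taylor (-α) (taylor α P) = P
      rw [taylor_taylor]; simp
    rw [e, map_pow] at h2
    have e2 : taylorAlgHom (-α) X = X - C α := by
      change taylor (-α) X = _
      simp [sub_eq_add_neg]
    rwa [e2] at h2
  have hprod : (∏ α ∈ G, (X - C α) ^ M) ∣ P := by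
    refine Finset.prod_dvd_of_coprime ?_ hd
    intro a _ b _ hab
    exact (isCoprime_X_sub_C_of_isUnit_sub (sub_ne_zero.2 hab).isUnit).pow
  refine eq_zero_of_dvd_of_degree_lt hprod ?_
  have : (∏ α ∈ G, (X - C α) ^ M).degree = ((M * G.card : ℕ) : WithBot ℕ) := by
    rw [degree_prod]
    simp [mul_comm]
  rw [this]; exact hP

lemma count_lower (q k : ℕ) (hq : 0 < q) (hk : k + 1 ≤ q) (N : ℕ) :
    N * (k + 1) ≤ q * ((Finset.range N).filter (fun n => n % q ≤ k)).card := by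
  induction N using Nat.strong_induction_on with
  | _ N ih =>
    by_cases hN : N < q
    · have : Finset.range (min N (k+1)) ⊆ (Finset.range N).filter (fun n => n % q ≤ k) := by
        intro n hn
        simp only [Finset.mem_range, Finset.mem_filter] at hn ⊢
        have : n < N := by omega
        rw [Nat.mod_eq_of_lt (by omega)]
        omega
      have h := Finset.card_le_card this
      rw [Finset.card_range] at h
      refine le_trans ?_ (Nat.mul_le_mul_left q h)
      rcases le_total N (k+1) with h1 | h1
      · rw [min_eq_left h1, mul_comm]; exact Nat.mul_le_mul_right _ hk
      · rw [min_eq_right h1]; exact Nat.mul_le_mul_right _ hN.le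
    · obtain ⟨N', rfl⟩ := Nat.exists_eq_add_of_le' (not_lt.1 hN)
      have h := ih N' (by omega)
      have hsub : (Finset.range (k+1)) ∪ ((Finset.range N').filter (fun n => n % q ≤ k)).image (· + q)
          ⊆ (Finset.range (N' + q)).filter (fun n => n % q ≤ k) := by
        intro n hn
        simp only [Finset.mem_union, Finset.mem_image, Finset.mem_range, Finset.mem_filter] at hn ⊢
        rcases hn with hn | ⟨a, ha, rfl⟩
        · rw [Nat.mod_eq_of_lt (by omega)]; omega
        · rw [Nat.add_mod_right]; omega
      have hc := Finset.card_le_card hsub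
      rw [Finset.card_union_of_disjoint, Finset.card_range, Finset.card_image_of_injective _
        (add_left_injective q)] at hc
      · nlinarith
      · rw [Finset.disjoint_left]
        intro n hn hn'
        simp only [Finset.mem_image, Finset.mem_range] at hn hn'
        obtain ⟨a, _, rfl⟩ := hn'
        omega

/-- **robust version, several polynomials.** Let `m ≥ 2`, `c, h, M` positive,
`γ ∈ [0,1)` with `c < (((m-1) - mγ)/m)·M`, and `r_1, …, r_m : 𝔽_q → 𝔽_q` such that the
number of `α` with `r_i(α) ≠ r_j(α)` for some pair `i, j` is at most `γq`. Suppose each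
`F_i ∈ 𝔽_q[X]` has degree `< cq` and is `r_i`-twisted `(h, M)`-pseudopolynomial, and let
`k > (M/((m-1-mγ)M - mc))·(h+1)`. Then there exist `A_1, …, A_m ∈ 𝔽_q[X]`, not all zero,
each of degree `< Mq` and pseudodegree at most `k`, with `Σ_i A_i·F_i = 0`. -/
theorem stmt17 {F : Type*} [Field F] [Fintype F] (q : ℕ) (hq : Fintype.card F = q)
    (m c h M : ℕ) (hm : 2 ≤ m) (hc : 0 < c) (hh : 0 < h) (hM : 0 < M)
    (γ : ℝ) (hγ0 : 0 ≤ γ) (hγ1 : γ < 1)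
    (hcM : (c : ℝ) < (((m : ℝ) - 1) - (m : ℝ) * γ) / (m : ℝ) * (M : ℝ))
    (r : Fin m → F → F)
    (hΔ : ({α : F | ∃ i j : Fin m, r i α ≠ r j α}.ncard : ℝ) ≤ γ * (q : ℝ))
    (Fi : Fin m → F[X])
    (hFdeg : ∀ i, (Fi i).degree < ((c * q : ℕ) : WithBot ℕ))
    (hFtw : ∀ i, Twisted (r i) h M (Fi i))
    (k : ℕ)
    (hk : (M : ℝ) / (((m : ℝ) - 1 - (m : ℝ) * γ) * (M : ℝ) - (m : ℝ) * (c : ℝ))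
        * ((h : ℝ) + 1) < (k : ℝ)) :
    ∃ A : Fin m → F[X], (¬ ∀ i, A i = 0) ∧
      (∀ i, (A i).degree < ((M * q : ℕ) : WithBot ℕ)) ∧
      (∀ i, PdegLE q (A i) k) ∧
      ∑ i, A i * Fi i = 0 := by
  classical
  have hq0 : 0 < q := hq ▸ Fintype.card_pos
  have hqR : (0 : ℝ) < q := by exact_mod_cast hq0
  have hmR : (0 : ℝ) < m := by exact_mod_cast (by omega : 0 < m)
  have hMR : (0 : ℝ) < M := by exact_mod_cast hM
  set G : Finset F := Finset.univ.filter (fun α => ∀ i j : Fin m, r i α = r j α) with hG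
  -- the good set
  have hGcard : (1 - γ) * q ≤ (G.card : ℝ) := by
    have e : {α : F | ∃ i j : Fin m, r i α ≠ r j α} = ((Gᶜ : Finset F) : Set F) := by
      ext α; simp [hG]
    rw [e, Set.ncard_coe_finset] at hΔ
    have := Finset.card_add_card_compl G
    rw [hq] at this
    have h2 : (G.card : ℝ) + (Gᶜ.card : ℝ) = q := by exact_mod_cast this
    linarith
  have hD : 0 < ((m : ℝ) - 1 - m * γ) * M - m * c := by
    have h1 : ((m : ℝ) - 1 - m * γ) / m * M * m = ((m : ℝ) - 1 - m * γ) * M := by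
      field_simp
    have := mul_lt_mul_of_pos_right hcM hmR
    rw [h1] at this
    linarith
  have hcG : c * q < M * G.card := by
    have h1 : (M : ℝ) * ((1 - γ) * q) ≤ M * G.card := mul_le_mul_of_nonneg_left hGcard hMR.le
    have h2 : (0:ℝ) < m * ((1 - γ) * M - c) := by nlinarith
    have h3 := (mul_pos_iff_of_pos_left hmR).1 h2
    have h4 : (0:ℝ) < ((1 - γ) * M - c) * q := mul_pos h3 hqR
    have : ((c * q : ℕ) : ℝ) < ((M * G.card : ℕ) : ℝ) := by push_cast; nlinarith
    exact_mod_cast this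
  obtain ⟨N, hN⟩ : ∃ N, M * G.card = c * q + N := Nat.exists_eq_add_of_le hcG.le
  have hGq : G.card ≤ q := hq ▸ Finset.card_le_univ G
  have hNM : N ≤ M * q := by
    have := Nat.mul_le_mul_left M hGq
    omega
  have hNR : ((1 - γ) * M - c) * q ≤ (N : ℝ) := by
    have : (M : ℝ) * G.card = c * q + N := by exact_mod_cast hN
    nlinarith [mul_le_mul_of_nonneg_left hGcard hMR.le]
  have key : ∀ A : Fin m → F[X], (∀ i, (A i).degree < (N : WithBot ℕ)) →
      (∀ α ∈ G, ∀ ℓ < M, (hasseDeriv ℓ (∑ i, A i * Fi i)).eval α = 0) →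
      ∑ i, A i * Fi i = 0 := by
    intro A hA h0
    refine vanish G M _ ?_ h0
    rw [← mem_degreeLT]
    refine Submodule.sum_mem _ fun i _ => ?_
    rw [mem_degreeLT]
    by_cases hz : A i * Fi i = 0
    · rw [hz, degree_zero]; exact WithBot.bot_lt_coe _
    have hz1 := left_ne_zero_of_mul hz
    have hz2 := right_ne_zero_of_mul hz
    have a1 := (natDegree_lt_iff_degree_lt hz1).2 (hA i)
    have a2 := (natDegree_lt_iff_degree_lt hz2).2 (hFdeg i)
    rw [← natDegree_lt_iff_degree_lt hz, natDegree_mul hz1 hz2]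
    omega
  by_cases hkq : k + 1 ≤ q
  · -- small pseudodegree
    have hU : ∀ i ℓ, ∃ U : F[X], ℓ < M → (U.degree ≤ (h : WithBot ℕ) ∧
        ∀ α : F, (hasseDeriv ℓ (Fi i)).eval α = r i α * U.eval α) := by
      intro i ℓ
      by_cases hl : ℓ < M
      · obtain ⟨U, hU⟩ := hFtw i ℓ hl
        exact ⟨U, fun _ => hU⟩
      · exact ⟨0, fun h => absurd h hl⟩
    choose U hU using hU
    let R : (Fin m → F[X]) → ℕ → F[X] := fun A ℓ =>
      ∑ i, ∑ ab ∈ Finset.HasAntidiagonal.antidiagonal ℓ, (hasseDeriv ab.1 (A i) %ₘ (X ^ q - X)) * U i ab.2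
    let T : (Fin m → F[X]) →ₗ[F] (Fin M × Fin (k + h + 1) → F) :=
      { toFun := fun A p => (R A p.1).coeff p.2
        map_add' := by
          intro A B
          funext p
          simp only [R, Pi.add_apply, map_add, add_modByMonic, add_mul, Finset.sum_add_distrib,
            coeff_add]
        map_smul' := by
          intro a A
          funext p
          simp only [R, Pi.smul_apply, map_smul, smul_modByMonic, smul_mul_assoc,
            ← Finset.smul_sum, coeff_smul, RingHom.id_apply] }
    have hcard : Fintype.card (Fin M × Fin (k + h + 1)) <
        m * ((Finset.range N).filter (fun n => n % q ≤ k)).card := by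
      have hc := count_lower q k hq0 hkq N
      set s := ((Finset.range N).filter (fun n => n % q ≤ k)).card
      have hcR : (N : ℝ) * (k + 1) ≤ q * s := by exact_mod_cast hc
      have h1 : ((1 - γ) * M - c) * (k + 1) ≤ (s : ℝ) := by
        have : (((1 - γ) * M - c) * (k + 1)) * q ≤ (s : ℝ) * q := by
          nlinarith [mul_le_mul_of_nonneg_right hNR (by positivity : (0:ℝ) ≤ (k:ℝ) + 1)]
        exact le_of_mul_le_mul_right this hqR
      have h2 : (M : ℝ) * (h + 1) < k * (((m : ℝ) - 1 - m * γ) * M - m * c) := by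
        rw [div_mul_eq_mul_div, div_lt_iff₀ hD] at hk
        exact hk
      have h3 : (m : ℝ) * (((1 - γ) * M - c) * (k + 1)) ≤ m * s :=
        mul_le_mul_of_nonneg_left h1 hmR.le
      have : ((M * (k + h + 1) : ℕ) : ℝ) < ((m * s : ℕ) : ℝ) := by
        push_cast
        nlinarith
      simp only [Fintype.card_prod, Fintype.card_fin]
      exact_mod_cast this
    obtain ⟨A, hA0, hAd, hAp, hT⟩ := core q hq m N k T hcard
    refine ⟨A, hA0, fun i => (hAd i).trans_le (by exact_mod_cast hNM), hAp, key A hAd ?_⟩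
    intro α hα ℓ hℓ
    have hRdeg : (R A ℓ).degree < ((k + h + 1 : ℕ) : WithBot ℕ) := by
      rw [← mem_degreeLT]
      refine Submodule.sum_mem _ fun i _ => Submodule.sum_mem _ fun ab hab => ?_
      rw [Finset.HasAntidiagonal.mem_antidiagonal] at hab
      rw [mem_degreeLT]
      have hu := (hU i ab.2 (by omega)).1
      have hb := hAp i ab.1
      refine (degree_mul_le_of_le hb hu).trans_lt ?_
      exact_mod_cast Nat.lt_succ_self (k + h)
    have hR0 : R A ℓ = 0 := by
      ext d
      by_cases hd : d < k + h + 1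
      · have := congrFun hT (⟨ℓ, hℓ⟩, ⟨d, hd⟩)
        simpa [T] using this
      · rw [coeff_eq_zero_of_degree_lt (hRdeg.trans_le (by exact_mod_cast not_lt.1 hd)), coeff_zero]
    have hmod : ∀ B : F[X], (B %ₘ (X ^ q - X)).eval α = B.eval α := by
      intro B
      have := congrArg (eval α) (modByMonic_add_div B (X ^ q - X : F[X]))
      rw [eval_add, eval_mul] at this
      have h0 : (X ^ q - X : F[X]).eval α = 0 := by
        simp [← hq, FiniteField.pow_card]
      rw [h0, zero_mul, add_zero] at this
      exact this
    have hm0 : 0 < m := by omega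
    have hr : ∀ i, r i α = r ⟨0, hm0⟩ α := by
      intro i
      have := (Finset.mem_filter.1 hα).2
      exact this i _
    have : (hasseDeriv ℓ (∑ i, A i * Fi i)).eval α = r ⟨0, hm0⟩ α * (R A ℓ).eval α := by
      simp only [R, map_sum, eval_finset_sum, hasseDeriv_mul, eval_mul, hmod, Finset.mul_sum]
      refine Finset.sum_congr rfl fun i _ => Finset.sum_congr rfl fun ab hab => ?_
      rw [Finset.HasAntidiagonal.mem_antidiagonal] at hab
      rw [(hU i ab.2 (by omega)).2 α, hr i]
      ring
    rw [this, hR0]; simp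
  · let T : (Fin m → F[X]) →ₗ[F] (Fin M × F → F) :=
      { toFun := fun A p => (hasseDeriv (p.1 : ℕ) (∑ i, A i * Fi i)).eval p.2
        map_add' := by
          intro A B
          funext p
          simp only [Pi.add_apply, map_add, add_mul, Finset.sum_add_distrib, eval_add]
        map_smul' := by
          intro a A
          funext p
          simp only [Pi.smul_apply, map_smul, smul_mul_assoc, ← Finset.smul_sum, eval_smul,
            RingHom.id_apply] }
    have hcard : Fintype.card (Fin M × F) <
        m * ((Finset.range N).filter (fun n => n % q ≤ k)).card := by
      have : (Finset.range N).filter (fun n => n % q ≤ k) = Finset.range N := by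
        refine Finset.filter_true_of_mem fun n _ => ?_
        have := Nat.mod_lt n hq0
        omega
      rw [this, Finset.card_range, Fintype.card_prod, Fintype.card_fin, hq]
      have : ((M * q : ℕ) : ℝ) < ((m * N : ℕ) : ℝ) := by
        push_cast
        have h1 := mul_le_mul_of_nonneg_left hNR hmR.le
        have h2 := mul_pos hD hqR
        nlinarith
      exact_mod_cast this
    obtain ⟨A, hA0, hAd, hAp, hT⟩ := core q hq m N k T hcard
    refine ⟨A, hA0, fun i => (hAd i).trans_le (by exact_mod_cast hNM), hAp, key A hAd ?_⟩
    intro α hα ℓ hℓ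
    exact congrFun hT (⟨ℓ, hℓ⟩, α)
end

section
/- Let q be an odd prime power, let ε be a real number with 0 < ε ≤ 1/2, and let d ≥ 1 be an integer with 64·d² ≤ ε²·q. Let f(X), g(X) ∈ 𝔽_q[X] be distinct monic squarefree polynomials, each of degree at most d. Then the number of α ∈ 𝔽_q with f(α)^{(q−1)/2} ≠ g(α)^{(q−1)/2} is at least (1/2 − ε)·q. -/
open Polynomial

theorem aux_dvd {F : Type*} [Field F] (f A : F[X]) (k : ℕ) :
    ∀ i, f ^ (k - i) ∣ hasseDeriv i (f ^ k * A) := by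
  induction k with
  | zero => intro i; simp
  | succ k ih =>
    intro i
    rw [pow_succ', mul_assoc, hasseDeriv_mul]
    refine Finset.dvd_sum fun x hx => ?_
    rw [Finset.HasAntidiagonal.mem_antidiagonal] at hx
    rcases Nat.eq_zero_or_pos x.1 with h | h
    · rw [h, hasseDeriv_zero]
      have hxi : x.2 = i := by omega
      rw [hxi]
      refine (pow_dvd_pow f (show k + 1 - i ≤ (k - i) + 1 by omega)).trans ?_
      rw [pow_succ']
      exact mul_dvd_mul dvd_rfl (ih i)
    · refine Dvd.dvd.mul_left ?_ _
      exact (pow_dvd_pow f (show k + 1 - i ≤ k - x.2 by omega)).trans (ih _)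

theorem aux_lin {F : Type*} [Field F] (f : F[X]) (hf : f.Monic) (k i : ℕ) (hik : i ≤ k) :
    ∃ L : F[X] →ₗ[F] F[X], (∀ A, hasseDeriv i (f ^ k * A) = f ^ (k - i) * L A) ∧
      ∀ A, (L A).natDegree ≤ A.natDegree + i * f.natDegree := by
  choose c hc using fun A => aux_dvd f A k i
  have h0 : f ^ (k - i) ≠ 0 := pow_ne_zero _ hf.ne_zero
  refine ⟨⟨⟨c, ?_⟩, ?_⟩, hc, ?_⟩
  · intro x y
    apply mul_left_cancel₀ h0
    rw [← hc, mul_add, mul_add, map_add, ← hc, ← hc]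
  · intro r x
    apply mul_left_cancel₀ h0
    dsimp only
    rw [← hc, mul_smul_comm, mul_smul_comm, map_smul, ← hc, RingHom.id_apply]
  · intro A
    change (c A).natDegree ≤ _
    by_cases hcA : c A = 0
    · simp [hcA]
    have h1 : (f ^ (k - i) * c A).natDegree = (k - i) * f.natDegree + (c A).natDegree := by
      rw [natDegree_mul h0 hcA, natDegree_pow]
    have h2 := natDegree_hasseDeriv_le (f ^ k * A) i
    have h3 : (f ^ k * A).natDegree ≤ k * f.natDegree + A.natDegree :=
      natDegree_mul_le.trans (by rw [natDegree_pow])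
    rw [hc, h1] at h2
    obtain ⟨t, rfl⟩ := Nat.exists_eq_add_of_le hik
    rw [Nat.add_sub_cancel_left] at h2
    rw [Nat.add_mul] at h3
    omega

theorem aux_inj {F : Type*} [Field F] (q : ℕ) (n : ℕ) : ∀ R : F[X][X], R.natDegree ≤ n →
    (∀ n, (R.coeff n).natDegree < q) → R.eval (X ^ q) = 0 → R = 0 := by
  induction n with
  | zero =>
    intro R hR _ h
    rw [eq_C_of_natDegree_le_zero hR] at h ⊢
    simpa using h
  | succ n ih =>
    intro R hR hc h
    have e := divX_mul_X_add R
    rw [← e, eval_add, eval_mul, eval_X, eval_C] at h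
    have h0 : R.coeff 0 = 0 := by
      apply eq_zero_of_dvd_of_natDegree_lt (p := X ^ q)
      · exact ⟨-eval (X ^ q) R.divX, by linear_combination h⟩
      · rw [natDegree_X_pow]; exact hc 0
    have h1 : R.divX = 0 := by
      apply ih
      · rw [natDegree_divX_eq_natDegree_tsub_one]; omega
      · intro m; rw [coeff_divX]; exact hc _
      · rw [h0, add_zero] at h
        exact (mul_eq_zero.mp h).resolve_right (pow_ne_zero _ X_ne_zero)
    rw [← e, h1, h0]; simp

theorem aux_mul {F : Type*} [Field F] (p r : F[X][X]) (b c : ℕ)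
    (hp : ∀ n, (p.coeff n).natDegree ≤ b) (hr : ∀ n, (r.coeff n).natDegree ≤ c) :
    ∀ n, ((p * r).coeff n).natDegree ≤ b + c := by
  intro n
  rw [coeff_mul]
  refine natDegree_sum_le_of_forall_le _ _ fun x _ => ?_
  exact natDegree_mul_le.trans (add_le_add (hp _) (hr _))

theorem aux_sf {F : Type*} [Field F] (f g A B : F[X]) (hf : f.Monic) (hg : g.Monic)
    (hfs : Squarefree f) (hgs : Squarefree g) (hA : A ≠ 0)
    (h : g * A ^ 2 = f * B ^ 2) : f = g := by
  classical
  obtain ⟨A', hA'⟩ := EuclideanDomain.gcd_dvd_left A B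
  obtain ⟨B', hB'⟩ := EuclideanDomain.gcd_dvd_right A B
  have hb := EuclideanDomain.gcd_eq_gcd_ab A B
  set D := EuclideanDomain.gcd A B with hD
  have hD0 : D ≠ 0 := by
    rintro h0
    rw [h0, zero_mul] at hA'
    exact hA hA'
  have hcop : IsCoprime A' B' := by
    refine ⟨EuclideanDomain.gcdA A B, EuclideanDomain.gcdB A B, ?_⟩
    apply mul_left_cancel₀ hD0
    linear_combination (-1 : F[X]) * hb - EuclideanDomain.gcdA A B * hA' -
      EuclideanDomain.gcdB A B * hB'
  have h' : g * A' ^ 2 = f * B' ^ 2 := by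
    apply mul_left_cancel₀ (pow_ne_zero 2 hD0)
    rw [hA', hB'] at h
    linear_combination h
  have hc2 : IsCoprime (A' ^ 2) (B' ^ 2) := hcop.pow
  have uA : IsUnit A' := by
    apply hfs
    rw [← pow_two]
    exact hc2.dvd_of_dvd_mul_right ⟨g, by rw [← h', mul_comm]⟩
  have uB : IsUnit B' := by
    apply hgs
    rw [← pow_two]
    exact hc2.symm.dvd_of_dvd_mul_right ⟨f, by rw [h', mul_comm]⟩
  apply eq_of_monic_of_associated hf hg
  have a1 : Associated (f * B' ^ 2) f := associated_mul_unit_left _ _ (uB.pow 2)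
  have a2 : Associated (g * A' ^ 2) g := associated_mul_unit_left _ _ (uA.pow 2)
  exact a1.symm.trans (h' ▸ a2)

theorem aux_nonvan {F : Type*} [Field F] [Fintype F] (q k a d : ℕ) (hq : Fintype.card F = q)
    (hk : q = 2 * k + 1) (f g : F[X]) (hfg : f ≠ g) (hf : f.Monic) (hg : g.Monic)
    (hfs : Squarefree f) (hgs : Squarefree g) (hfd : f.natDegree ≤ d) (hgd : g.natDegree ≤ d)
    (A B : F[X][X]) (hA : ∀ n, (A.coeff n).natDegree ≤ a) (hB : ∀ n, (B.coeff n).natDegree ≤ a)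
    (hadq : 2 * a + d < q)
    (h : f ^ k * A.eval (X ^ q) + g ^ k * B.eval (X ^ q) = 0) : A = 0 ∧ B = 0 := by
  have hev : ∀ p : F[X], (p.map C).eval (X ^ q) = p ^ q := by
    intro p
    rw [← hq, ← FiniteField.expand_card p, eval_map, expand_eq_comp_X_pow]
    rfl
  have hmapc : ∀ p : F[X], ∀ n, ((p.map (C : F →+* F[X])).coeff n).natDegree ≤ 0 := by
    intro p n
    rw [coeff_map, natDegree_C]
  have hCc : ∀ p : F[X], p.natDegree ≤ d → ∀ n, ((C p).coeff n).natDegree ≤ d := by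
    intro p hp n
    rw [coeff_C]
    split_ifs
    · exact hp
    · simp
  have key : f.map C * (C g * (A * A)) - g.map C * (C f * (B * B)) = 0 := by
    apply aux_inj q _ _ le_rfl
    · intro n
      rw [coeff_sub]
      have h1 := aux_mul _ _ _ _ (hmapc f) (aux_mul _ _ _ _ (hCc g hgd) (aux_mul _ _ _ _ hA hA)) n
      have h2 := aux_mul _ _ _ _ (hmapc g) (aux_mul _ _ _ _ (hCc f hfd) (aux_mul _ _ _ _ hB hB)) n
      have := natDegree_sub_le_of_le h1 h2
      rw [max_self] at this
      omega
    · simp only [eval_sub, eval_mul, hev, eval_C]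
      have e : ∀ p : F[X], p ^ q = p ^ k * p ^ k * p := by
        intro p; rw [hk]; ring
      rw [e f, e g]
      linear_combination f * g * (f ^ k * A.eval (X ^ q) - g ^ k * B.eval (X ^ q)) * h
  have key2 := congrArg leadingCoeff (sub_eq_zero.mp key)
  simp only [leadingCoeff_mul, leadingCoeff_C] at key2
  rw [(hf.map C).leadingCoeff, (hg.map C).leadingCoeff, one_mul, one_mul, ← pow_two,
    ← pow_two] at key2
  have hA0 : A = 0 := by
    by_contra hA0
    exact hfg (aux_sf f g _ _ hf hg hfs hgs (leadingCoeff_ne_zero.mpr hA0) key2)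
  refine ⟨hA0, ?_⟩
  rw [hA0] at key2
  simpa [hf.ne_zero] using key2.symm

theorem aux_exists {F : Type*} [Field F] (k M J a d : ℕ)
    (hM : M ≤ k) (ha : 1 ≤ a) (hcount : M * (J + a + 2 * d * M) < 2 * (J * a))
    (f g : F[X]) (hf : f.Monic) (hg : g.Monic)
    (hfd : f.natDegree ≤ d) (hgd : g.natDegree ≤ d) :
    ∃ x y : Fin J → F[X], (∀ j, (x j).natDegree < a) ∧ (∀ j, (y j).natDegree < a) ∧
      ¬ ((∀ j, x j = 0) ∧ (∀ j, y j = 0)) ∧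
      ∀ α : F, (f.eval α) ^ k = (g.eval α) ^ k →
        (X - C α) ^ M ∣ ∑ j : Fin J, C (α ^ (j : ℕ)) * (f ^ k * x j + g ^ k * y j) := by
  classical
  choose Lf hLf hLfd using fun i : Fin M => aux_lin f hf k i (by omega)
  choose Lg hLg hLgd using fun i : Fin M => aux_lin g hg k i (by omega)
  set N := J + a + 2 * d * M with hN
  let V := (Fin J → degreeLT F a) × (Fin J → degreeLT F a)
  let p1 : Fin J → V →ₗ[F] F[X] := fun j =>
    (degreeLT F a).subtype ∘ₗ LinearMap.proj j ∘ₗ LinearMap.fst F _ _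
  let p2 : Fin J → V →ₗ[F] F[X] := fun j =>
    (degreeLT F a).subtype ∘ₗ LinearMap.proj j ∘ₗ LinearMap.snd F _ _
  let E : Fin M → V →ₗ[F] F[X] := fun i => ∑ j : Fin J,
    LinearMap.mulLeft F (X ^ (j : ℕ)) ∘ₗ
      (LinearMap.mulLeft F (g ^ (i : ℕ)) ∘ₗ Lf i ∘ₗ p1 j +
       LinearMap.mulLeft F (f ^ (i : ℕ)) ∘ₗ Lg i ∘ₗ p2 j)
  have hE : ∀ i v, E i v = ∑ j : Fin J, X ^ (j : ℕ) *
      (g ^ (i : ℕ) * Lf i (v.1 j : F[X]) + f ^ (i : ℕ) * Lg i (v.2 j : F[X])) := by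
    intro i v
    simp [E, p1, p2, LinearMap.sum_apply]
    rfl
  have hdeg : ∀ z : degreeLT F a, (z : F[X]).natDegree < a := by
    intro z
    have hz := mem_degreeLT.mp z.2
    by_cases h0 : (z : F[X]) = 0
    · rw [h0, natDegree_zero]; omega
    · exact (natDegree_lt_iff_degree_lt h0).mpr hz
  let Φ : V →ₗ[F] (Fin M → Fin N → F) :=
    LinearMap.pi fun i => LinearMap.pi fun n => lcoeff F (n : ℕ) ∘ₗ E i
  have hfr : ∀ n, Module.finrank F (degreeLT F n) = n := by
    intro n
    rw [(degreeLTEquiv F n).finrank_eq, Module.finrank_fin_fun]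
  have : FiniteDimensional F (degreeLT F a) := (degreeLTEquiv F a).symm.finiteDimensional
  have hker : LinearMap.ker Φ ≠ ⊥ := by
    apply LinearMap.ker_ne_bot_of_finrank_lt
    simp only [V, Module.finrank_prod, Module.finrank_pi_fintype, hfr, Finset.sum_const,
      Finset.card_univ, Fintype.card_fin, smul_eq_mul, Module.finrank_self, mul_one]
    omega
  obtain ⟨v, hv, hv0⟩ := (Submodule.ne_bot_iff _).mp hker
  have hEv : ∀ i, E i v = 0 := by
    intro i
    ext n
    rw [coeff_zero]
    by_cases hn : n < N
    · exact congrFun (congrFun (LinearMap.mem_ker.mp hv) i) ⟨n, hn⟩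
    · apply coeff_eq_zero_of_natDegree_lt
      refine lt_of_lt_of_le ?_ (not_lt.mp hn)
      refine lt_of_le_of_lt (b := J + (a - 1) + 2 * d * M) ?_ (by omega)
      rw [hE]
      refine natDegree_sum_le_of_forall_le _ _ fun j _ => ?_
      have hi : (i : ℕ) ≤ M := i.2.le
      have hterm : ∀ (p r : F[X]), p.natDegree ≤ d → r.natDegree ≤ (a - 1) + i * d →
          (p ^ (i : ℕ) * r).natDegree ≤ (a - 1) + 2 * d * M := by
        intro p r hp hr
        have e1 : (p ^ (i : ℕ) * r).natDegree ≤ i * p.natDegree + r.natDegree :=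
          natDegree_mul_le.trans (by rw [natDegree_pow])
        have e2 : (i : ℕ) * p.natDegree ≤ M * d := Nat.mul_le_mul hi hp
        have e3 : (i : ℕ) * d ≤ M * d := Nat.mul_le_mul_right _ hi
        nlinarith
      have hr1 : (Lf i (v.1 j : F[X])).natDegree ≤ (a - 1) + i * d := by
        refine (hLfd i _).trans (add_le_add ?_ (Nat.mul_le_mul_left _ hfd))
        have := hdeg (v.1 j); omega
      have hr2 : (Lg i (v.2 j : F[X])).natDegree ≤ (a - 1) + i * d := by
        refine (hLgd i _).trans (add_le_add ?_ (Nat.mul_le_mul_left _ hgd))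
        have := hdeg (v.2 j); omega
      refine natDegree_mul_le.trans ?_
      rw [natDegree_X_pow, add_assoc]
      refine add_le_add j.2.le ?_
      exact natDegree_add_le_of_degree_le (hterm _ _ hgd hr1) (hterm _ _ hfd hr2)
  refine ⟨fun j => v.1 j, fun j => v.2 j, fun j => hdeg _, fun j => hdeg _, ?_, ?_⟩
  · rintro ⟨h1, h2⟩
    apply hv0
    refine Prod.ext ?_ ?_
    · funext j; exact Subtype.ext (h1 j)
    · funext j; exact Subtype.ext (h2 j)
  intro α hα
  by_cases hk0 : k = 0
  · have : M = 0 := by omega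
    simp [this]
  by_cases hfα : f.eval α = 0
  · have hgα : g.eval α = 0 := by
      rw [hfα, zero_pow hk0] at hα
      exact pow_eq_zero_iff hk0 |>.mp hα.symm
    have d1 : (X - C α) ^ M ∣ f ^ k :=
      (pow_dvd_pow _ hM).trans (pow_dvd_pow_of_dvd (dvd_iff_isRoot.mpr hfα) k)
    have d2 : (X - C α) ^ M ∣ g ^ k :=
      (pow_dvd_pow _ hM).trans (pow_dvd_pow_of_dvd (dvd_iff_isRoot.mpr hgα) k)
    refine Finset.dvd_sum fun j _ => Dvd.dvd.mul_left ?_ _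
    exact dvd_add (d1.mul_right _) (d2.mul_right _)
  have hgα : g.eval α ≠ 0 := by
    intro h
    rw [h, zero_pow hk0] at hα
    exact hfα (pow_eq_zero_iff hk0 |>.mp hα)
  set P := ∑ j : Fin J, C (α ^ (j : ℕ)) * (f ^ k * (v.1 j : F[X]) + g ^ k * (v.2 j : F[X])) with hP
  have hco : X ^ M ∣ taylor α P := by
    rw [X_pow_dvd_iff]
    intro i hi
    rw [taylor_coeff]
    have hh := congrArg (eval α) (hEv ⟨i, hi⟩)
    rw [hE] at hh
    simp only [eval_finsetSum, eval_mul, eval_add, eval_pow, eval_X, eval_zero] at hh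
    have hD : (f.eval α) ^ i * (g.eval α) ^ i * eval α (hasseDeriv i P) = 0 := by
      have l1 : ∀ A, hasseDeriv i (f ^ k * A) = f ^ (k - i) * Lf ⟨i, hi⟩ A := hLf ⟨i, hi⟩
      have l2 : ∀ A, hasseDeriv i (g ^ k * A) = g ^ (k - i) * Lg ⟨i, hi⟩ A := hLg ⟨i, hi⟩
      simp only [hP, ← smul_eq_C_mul, map_sum, map_smul, map_add, l1, l2, eval_finsetSum, eval_smul, eval_add, eval_mul, eval_pow, smul_eq_mul]
      rw [← mul_zero (eval α f ^ k), ← hh, Finset.mul_sum, Finset.mul_sum]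
      refine Finset.sum_congr rfl fun j _ => ?_
      have e1 : eval α f ^ k = eval α f ^ i * eval α f ^ (k - i) := by
        rw [← pow_add]; congr 1; omega
      have e2 : eval α g ^ k = eval α g ^ i * eval α g ^ (k - i) := by
        rw [← pow_add]; congr 1; omega
      rw [e1, e2] at hα
      rw [e1]
      linear_combination (-1 : F) * eval α f ^ i * α ^ (j : ℕ) *
        eval α (Lg ⟨i, hi⟩ (v.2 j : F[X])) * hα
    exact (mul_eq_zero.mp hD).resolve_left
      (mul_ne_zero (pow_ne_zero _ hfα) (pow_ne_zero _ hgα))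
  have := map_dvd (taylorEquiv α).symm hco
  have e : (taylorEquiv α).symm (taylor α P) = P := (taylorEquiv α).symm_apply_apply P
  rw [e, map_pow] at this
  convert this using 2
  rw [AlgEquiv.eq_symm_apply]
  simp [taylorEquiv]

theorem aux_core {F : Type*} [Field F] [Fintype F] (q k M J a d : ℕ) (hq : Fintype.card F = q)
    (hk : q = 2 * k + 1) (hM : M ≤ k) (ha : 1 ≤ a) (haq : 2 * a + d ≤ q)
    (hcount : M * (J + a + 2 * d * M) < 2 * (J * a))
    (f g : F[X]) (hfg : f ≠ g) (hf : f.Monic) (hg : g.Monic)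
    (hfs : Squarefree f) (hgs : Squarefree g)
    (hfd : f.natDegree ≤ d) (hgd : g.natDegree ≤ d) (S : Finset F)
    (hS : ∀ α ∈ S, (f.eval α) ^ k = (g.eval α) ^ k) :
    M * S.card + q ≤ q * J + a + k * d := by
  classical
  obtain ⟨x, y, hx, hy, hxy, hdvd⟩ := aux_exists k M J a d hM ha hcount f g hf hg hfd hgd
  let T : (Fin J → F[X]) → F[X][X] := fun z => ∑ j : Fin J, C (z j) * X ^ (j : ℕ)
  have hTc : ∀ z (j : Fin J), (T z).coeff j = z j := by
    intro z j
    simp only [T, finsetSum_coeff, coeff_C_mul, coeff_X_pow]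
    simp [← Fin.ext_iff]
  have hTd : ∀ z, (∀ j, (z j).natDegree < a) → ∀ n, ((T z).coeff n).natDegree ≤ a - 1 := by
    intro z hz n
    by_cases hn : n < J
    · have := hTc z ⟨n, hn⟩
      have h2 := hz ⟨n, hn⟩
      simp only at this
      rw [this]; omega
    · have : (T z).coeff n = 0 := by
        simp only [T, finsetSum_coeff, coeff_C_mul, coeff_X_pow]
        refine Finset.sum_eq_zero fun j _ => ?_
        rw [if_neg (by have := j.2; omega), mul_zero]
      simp [this]
  have hTe : ∀ z, (T z).eval (X ^ q) = ∑ j : Fin J, z j * (X ^ q) ^ (j : ℕ) := by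
    intro z
    simp [T, eval_finsetSum]
  set P := f ^ k * (T x).eval (X ^ q) + g ^ k * (T y).eval (X ^ q) with hP
  have hPe : P = ∑ j : Fin J, (X ^ q) ^ (j : ℕ) * (f ^ k * x j + g ^ k * y j) := by
    rw [hP, hTe, hTe, Finset.mul_sum, Finset.mul_sum, ← Finset.sum_add_distrib]
    exact Finset.sum_congr rfl fun j _ => by ring
  have hP0 : P ≠ 0 := by
    intro h
    obtain ⟨h1, h2⟩ := aux_nonvan q k (a - 1) d hq hk f g hfg hf hg hfs hgs hfd hgd _ _
      (hTd x hx) (hTd y hy) (by omega) h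
    apply hxy
    constructor
    · intro j; rw [← hTc x j, h1, coeff_zero]
    · intro j; rw [← hTc y j, h2, coeff_zero]
  have hfrob : ∀ α : F, (X - C α) ^ q = X ^ q - C α := by
    intro α
    obtain ⟨p, hp⟩ := CharP.exists F
    obtain ⟨n, hpp, hn⟩ := FiniteField.card F p
    have := Fact.mk hpp
    have : (C α : F[X]) ^ q = C α := by rw [← C_pow, ← hq, FiniteField.pow_card]
    conv_rhs => rw [← this]
    rw [← hq, hn, sub_pow_char_pow]
  have hmul : ∀ α ∈ S, (X - C α) ^ M ∣ P := by
    intro α hα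
    have h1 := hdvd α (hS α hα)
    rw [← dvd_sub_left h1] at *
    rw [hPe, ← Finset.sum_sub_distrib]
    refine Finset.dvd_sum fun j _ => ?_
    rw [← sub_mul, C_pow]
    refine Dvd.dvd.mul_right ?_ _
    refine Dvd.dvd.trans ?_ (sub_dvd_pow_sub_pow _ _ _)
    rw [← hfrob]
    exact pow_dvd_pow _ (by omega)
  have hprod : ∏ α ∈ S, (X - C α) ^ M ∣ P := by
    refine Finset.prod_dvd_of_coprime ?_ hmul
    intro α _ β _ hne
    exact (pairwise_coprime_X_sub_C Function.injective_id hne).pow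
  have hdeg := natDegree_le_of_dvd hprod hP0
  rw [natDegree_prod_of_monic _ _ fun α _ => (monic_X_sub_C α).pow M] at hdeg
  simp only [natDegree_pow, natDegree_X_sub_C, mul_one, Finset.sum_const, smul_eq_mul] at hdeg
  have hJ : 1 ≤ J := by
    by_contra h
    have : J = 0 := by omega
    subst this
    simp at hcount
  have hPd : P.natDegree ≤ q * (J - 1) + (a + k * d) := by
    rw [hPe]
    refine natDegree_sum_le_of_forall_le _ _ fun j _ => ?_
    refine natDegree_mul_le.trans ?_
    rw [← pow_mul, natDegree_X_pow]
    refine add_le_add (Nat.mul_le_mul_left _ (by have := j.2; omega)) ?_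
    have hterm : ∀ (p r : F[X]), p.natDegree ≤ d → r.natDegree < a →
        (p ^ k * r).natDegree ≤ a + k * d := by
      intro p r hp hr
      have e1 : (p ^ k * r).natDegree ≤ k * p.natDegree + r.natDegree :=
        natDegree_mul_le.trans (by rw [natDegree_pow])
      have e2 : k * p.natDegree ≤ k * d := Nat.mul_le_mul_left _ hp
      omega
    exact natDegree_add_le_of_degree_le (hterm _ _ hfd (hx j)) (hterm _ _ hgd (hy j))
  obtain ⟨J', rfl⟩ := Nat.exists_eq_add_of_le' hJ
  rw [Nat.add_sub_cancel] at hPd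
  rw [mul_add, mul_one, mul_comm M]
  omega

/-- **Weil bound for the quadratic residue character, distance form.**
Let `q` be an odd prime power, `0 < ε ≤ 1/2`, and `d ≥ 1` with `64·d² ≤ ε²·q`. Let
`f, g ∈ 𝔽_q[X]` be distinct monic squarefree polynomials of degree at most `d`. Then the
number of `α ∈ 𝔽_q` with `f(α)^((q-1)/2) ≠ g(α)^((q-1)/2)` is at least `(1/2 - ε)·q`. -/
theorem stmt18 {F : Type*} [Field F] [Fintype F] (q : ℕ) (hq : Fintype.card F = q)
    (hodd : Odd q)
    (ε : ℝ) (hε0 : 0 < ε) (hε1 : ε ≤ 1 / 2)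
    (d : ℕ) (hd : 1 ≤ d) (hdq : 64 * (d : ℝ) ^ 2 ≤ ε ^ 2 * (q : ℝ))
    (f g : F[X]) (hfg : f ≠ g)
    (hfm : f.Monic) (hgm : g.Monic)
    (hfsf : Squarefree f) (hgsf : Squarefree g)
    (hfd : f.degree ≤ (d : ℕ)) (hgd : g.degree ≤ (d : ℕ)) :
    (1 / 2 - ε) * (q : ℝ) ≤
      (({α : F | (f.eval α) ^ ((q - 1) / 2) ≠ (g.eval α) ^ ((q - 1) / 2)}.ncard : ℝ)) := by
  classical
  obtain ⟨k, hk⟩ := hodd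
  have hk2 : (q - 1) / 2 = k := by omega
  rw [hk2]
  have h256 : 256 * d ^ 2 ≤ q := by
    have h1 : ε ^ 2 ≤ 1 / 4 := by nlinarith
    have h2 : ε ^ 2 * (q : ℝ) ≤ 1 / 4 * q := mul_le_mul_of_nonneg_right h1 (Nat.cast_nonneg _)
    have h3 : (256 : ℝ) * (d : ℝ) ^ 2 ≤ q := by linarith
    exact_mod_cast h3
  obtain ⟨M, hM1, hM2⟩ : ∃ M : ℕ, M * M ≤ q ∧ q < (M + 1) * (M + 1) :=
    ⟨Nat.sqrt q, Nat.sqrt_le q, Nat.lt_succ_sqrt q⟩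
  have hMd : 16 * d ≤ M := by
    by_contra h
    have : M + 1 ≤ 16 * d := by omega
    nlinarith
  have hM16 : 16 * M ≤ q := by nlinarith
  obtain ⟨J, hJ1, hJ2⟩ : ∃ J : ℕ, M + 6 * d + 1 ≤ 2 * J ∧ 2 * J ≤ M + 6 * d + 2 :=
    ⟨M / 2 + 3 * d + 1, by omega, by omega⟩
  obtain ⟨a, ha1, ha2⟩ : ∃ a : ℕ, 2 * a + d ≤ q ∧ q ≤ 2 * a + d + 1 :=
    ⟨(q - d) / 2, by omega, by omega⟩
  have hcount : M * (J + a + 2 * d * M) < 2 * (J * a) := by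
    have e1 : a * (M + 6 * d + 1) ≤ a * (2 * J) := Nat.mul_le_mul_left _ hJ1
    have e2 : q * (6 * d + 1) ≤ (2 * a + d + 1) * (6 * d + 1) := Nat.mul_le_mul_right _ ha2
    have e3 : M * (2 * J) ≤ M * (M + 6 * d + 2) := Nat.mul_le_mul_left _ hJ2
    have e4 : d * (M * M) ≤ d * q := Nat.mul_le_mul_left _ hM1
    have e5 : d * (16 * M) ≤ d * q := Nat.mul_le_mul_left _ hM16
    have e6 : d * (16 * d) ≤ d * M := Nat.mul_le_mul_left _ hMd
    have e7 : 1 * M ≤ d * M := Nat.mul_le_mul_right _ hd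
    have e8 : 1 * d ≤ d * d := Nat.mul_le_mul_right _ hd
    nlinarith
  set S : Finset F := Finset.univ.filter fun α => (f.eval α) ^ k = (g.eval α) ^ k with hS
  have hcore := aux_core q k M J a d hq hk (by omega) (by omega) ha1 hcount f g hfg hfm hgm
    hfsf hgsf (natDegree_le_of_degree_le hfd) (natDegree_le_of_degree_le hgd) S
    (by intro α hα; simpa [hS] using hα)
  have hset : {α : F | (f.eval α) ^ k ≠ (g.eval α) ^ k} = ((Sᶜ : Finset F) : Set F) := by
    ext α; simp [hS]
  have hcard : S.card + (Sᶜ).card = q := by rw [Finset.card_add_card_compl, hq]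
  rw [hset, Set.ncard_coe_finset]
  have hbound : 2 * (M * S.card) ≤ q * M + 8 * (d * q) := by
    have e3 : q * (2 * J) ≤ q * (M + 6 * d + 2) := Nat.mul_le_mul_left _ hJ2
    have e4 : 2 * k * d ≤ q * d := Nat.mul_le_mul_right _ (by omega)
    have e5 : 1 * q ≤ d * q := Nat.mul_le_mul_right _ hd
    nlinarith
  have hM0 : (0 : ℝ) < M := by
    have : 0 < M := by omega
    exact_mod_cast this
  have h4d : 4 * (d : ℝ) ≤ ε * M := by
    have h1 : q ≤ 4 * (M * M) := by nlinarith
    have h1' : (q : ℝ) ≤ 4 * ((M : ℝ) * M) := by exact_mod_cast h1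
    have h2 : ε ^ 2 * (q : ℝ) ≤ ε ^ 2 * (4 * ((M : ℝ) * M)) :=
      mul_le_mul_of_nonneg_left h1' (sq_nonneg _)
    refine abs_le_of_sq_le_sq' (a := 4 * (d : ℝ)) (b := ε * M) ?_ (by positivity) |>.2
    nlinarith
  have hb : 2 * ((M : ℝ) * S.card) ≤ q * M + 8 * (d * q) := by exact_mod_cast hbound
  have hc : (S.card : ℝ) + ((Sᶜ).card : ℝ) = q := by exact_mod_cast hcard
  have hfin : (S.card : ℝ) ≤ (1 / 2 + ε) * q := by
    have h5 : 4 * (d : ℝ) * q ≤ ε * M * q := mul_le_mul_of_nonneg_right h4d (Nat.cast_nonneg _)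
    refine le_of_mul_le_mul_left ?_ hM0
    linarith
  linarith
end
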